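/- Let P be a field, n ≥ 1, and let G be a subgroup of GL_n(P) in which every element is a nil-element. Then G is locally nilpotent. -/

import Mathlib

/-- Engel words with the convention of the paper: the commutator is
`[x, y] = x⁻¹ * y⁻¹ * x * y`, `engelWord 0 x y = x` and
`engelWord (n+1) x y = [engelWord n x y, y]`; thus for `n ≥ 1`,
`engelWord n x y` is the Engel word `e_n(x, y)`. -/
def engelWord {G : Type*} [Group G] : ℕ → G → G → G
  | 0, x, _ => x
  | n + 1, x, y => (engelWord n x y)⁻¹ * y⁻¹ * engelWord n x y * y

/-- Iterated Engel words: `epsEngel [(n₁,a₁),…,(n_k,a_k)] y` is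
`ε_{(n₁,…,n_k)}(a₁,…,a_k; y)`, defined by `ε_{(n₁)}(a₁;y) = e_{n₁}(a₁,y)` and
`ε_{(n₁,…,n_k)}(a₁,…,a_k;y) = e_{n_k}(a_k, ε_{(n₁,…,n_{k-1})}(a₁,…,a_{k-1};y))`. -/
def epsEngel {G : Type*} [Group G] (l : List (ℕ × G)) (y : G) : G :=
  l.foldl (fun z p => engelWord p.1 p.2 z) y

/-- `g` is a nil-element if for every `a` there is `n ≥ 1` with `e_n(a, g) = 1`. -/
def IsNilElement {G : Type*} [Group G] (g : G) : Prop :=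
  ∀ a : G, ∃ n, 1 ≤ n ∧ engelWord n a g = 1

/-- A group is locally nilpotent if every finitely generated subgroup is nilpotent. -/
def LocallyNilpotent (G : Type*) [Group G] : Prop :=
  ∀ H : Subgroup G, H.FG → Group.IsNilpotent H

/-- `g` is quasi-nil of order ≤ `k`: there are functions `ν i : G^(i+1) → ℕ` (with values ≥ 1,
`ν i` depending only on `a₁,…,a_{i+1}` and `g`) such that for all `a : Fin k → G`,
`ε_{(ν₁(a₁),…,ν_k(a₁,…,a_k))}(a₁,…,a_k; g) = 1`. -/
def IsQuasiNilOfOrder {G : Type*} [Group G] (k : ℕ) (g : G) : Prop :=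
  ∃ ν : ∀ i : Fin k, (Fin ((i : ℕ) + 1) → G) → ℕ,
    (∀ i f, 1 ≤ ν i f) ∧
    ∀ a : Fin k → G,
      epsEngel (List.ofFn fun i : Fin k =>
        (ν i fun j => a (Fin.castLE i.isLt j), a i)) g = 1

/-- `g` is quasi-nil if it is quasi-nil of order ≤ `k` for some `k ≥ 1`. -/
def IsQuasiNil {G : Type*} [Group G] (g : G) : Prop :=
  ∃ k, 1 ≤ k ∧ IsQuasiNilOfOrder k g

/-- `g` maps to a nil-element of the quotient `G ⧸ N` (for `N` normal). -/
def IsNilElementQuot {G : Type*} [Group G] (N : Subgroup G) (hN : N.Normal) (g : G) : Prop :=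
  @IsNilElement (G ⧸ N) (@QuotientGroup.Quotient.group G _ N hN) (QuotientGroup.mk g)

open Subgroup
open scoped commutatorElement

/-- A group all of whose elements are nil-elements. -/
def IsEngelGroup (G : Type*) [Group G] : Prop :=
  ∀ g : G, IsNilElement g

theorem map_engelWord {G H : Type*} [Group G] [Group H] (f : G →* H) (n : ℕ) (x y : G) :
    f (engelWord n x y) = engelWord n (f x) (f y) := by
  induction n with
  | zero => rfl
  | succ n ih => simp [engelWord, ih]

theorem engelWord_succ' {G : Type*} [Group G] (n : ℕ) (x y : G) :
    engelWord (n + 1) x y = engelWord n (x⁻¹ * y⁻¹ * x * y) y := by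
  induction n with
  | zero => rfl
  | succ n ih => rw [engelWord, ih]; rfl

theorem engelWord_mem {G : Type*} [Group G] {N : Subgroup G} [hN : N.Normal] {x : G} (hx : x ∈ N)
    (y : G) (n : ℕ) : engelWord n x y ∈ N := by
  induction n with
  | zero => exact hx
  | succ n ih =>
    have := N.mul_mem (N.inv_mem ih) (hN.conj_mem _ ih y⁻¹)
    simpa [engelWord, mul_assoc] using this

namespace IsEngelGroup

theorem of_surjective {G H : Type*} [Group G] [Group H] (h : IsEngelGroup G) (f : G →* H)
    (hf : Function.Surjective f) : IsEngelGroup H := by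
  intro g a
  obtain ⟨g, rfl⟩ := hf g
  obtain ⟨a, rfl⟩ := hf a
  obtain ⟨n, hn, e⟩ := h g a
  exact ⟨n, hn, by rw [← map_engelWord, e, map_one]⟩

theorem subgroup {G : Type*} [Group G] (h : IsEngelGroup G) (H : Subgroup G) :
    IsEngelGroup H := by
  intro g a
  obtain ⟨n, hn, e⟩ := h (g : G) a
  exact ⟨n, hn, Subtype.ext (by simpa [e] using map_engelWord H.subtype n a g)⟩

end IsEngelGroup

/-- The Engel words in `x` with a nil-element `t` generate a `t`-invariant finitely generated
subgroup. -/
theorem IsNilElement.exists_finite_mem_normalizer {G : Type*} [Group G] {t : G}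
    (ht : IsNilElement t) {N : Subgroup G} [N.Normal] {x : G} (hx : x ∈ N) :
    ∃ E : Set G, E.Finite ∧ x ∈ E ∧ E ⊆ N ∧ t ∈ normalizer (closure E : Set G) := by
  obtain ⟨k, -, hk⟩ := ht x
  let E : Set G := (fun i => engelWord i x t) '' Set.Iic k
  have mem (i : ℕ) (hi : i ≤ k) : engelWord i x t ∈ closure E :=
    subset_closure ⟨i, hi, rfl⟩
  have conj (i : ℕ) : t⁻¹ * engelWord i x t * t = engelWord i x t * engelWord (i + 1) x t := by
    simp [engelWord, mul_assoc]
  have up (i : ℕ) (hi : i ≤ k) : t⁻¹ * engelWord i x t * t ∈ closure E := by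
    rcases hi.lt_or_eq with hi | rfl
    · rw [conj]
      exact mul_mem (mem i hi.le) (mem (i + 1) hi)
    · simp [hk]
  have down (j : ℕ) (hj : j ≤ k) : t * engelWord (k - j) x t * t⁻¹ ∈ closure E := by
    induction j with
    | zero => simp [hk]
    | succ j ih =>
      have h := mul_mem (mem (k - (j + 1)) (by omega)) (inv_mem (ih (by omega)))
      have e := conj (k - (j + 1))
      rw [show k - (j + 1) + 1 = k - j by omega] at e
      convert h using 1
      rw [eq_mul_inv_iff_mul_eq]
      have : engelWord (k - j) x t = (engelWord (k - (j + 1)) x t)⁻¹ *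
          (t⁻¹ * engelWord (k - (j + 1)) x t * t) := by rw [e]; group
      rw [this]
      group
  refine ⟨E, (Set.finite_Iic k).image _, ⟨0, Nat.zero_le k, rfl⟩, ?_, ?_⟩
  · rintro _ ⟨i, -, rfl⟩
    exact engelWord_mem hx t i
  · have h1 : closure E ≤ (closure E).comap (MulAut.conj t).toMonoidHom := by
      rw [closure_le]
      rintro _ ⟨i, hi, rfl⟩
      have := down (k - i) (by omega)
      rw [show k - (k - i) = i by simp at hi; omega] at this
      simpa using this
    have h2 : closure E ≤ (closure E).comap (MulAut.conj t⁻¹).toMonoidHom := by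
      rw [closure_le]
      rintro _ ⟨i, hi, rfl⟩
      simpa using up i hi
    rw [mem_normalizer_iff]
    refine fun h => ⟨fun hh => by simpa using h1 hh, fun hh => ?_⟩
    have := h2 hh
    simpa [mul_assoc] using this

/-- In an Engel group, a normal subgroup with finitely generated extension by a cyclic group is
finitely generated. -/
theorem IsEngelGroup.fg_of_sup_zpowers {G : Type*} [Group G] (h : IsEngelGroup G)
    (N : Subgroup G) [N.Normal] (t : G) (hfg : (N ⊔ zpowers t).FG) : N.FG := by
  classical
  obtain ⟨Y, hY⟩ := hfg
  have hdec : ∀ y ∈ Y, ∃ x ∈ N, ∃ z ∈ zpowers t, x * z = y := fun y hy => by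
    have : y ∈ N ⊔ zpowers t := hY ▸ subset_closure hy
    exact mem_sup_of_normal_left.1 this
  choose! x hx z hz hxz using hdec
  have hE : ∀ y ∈ Y, ∃ E : Set G, E.Finite ∧ x y ∈ E ∧ E ⊆ N ∧
      t ∈ normalizer (closure E : Set G) := fun y hy =>
    (h t).exists_finite_mem_normalizer (hx y hy)
  choose! E hEf hxE hEN ht using hE
  let S : Subgroup G := ⨆ y : Y, closure (E y)
  have hSfg : S.FG := Subgroup.FG.iSup _ fun y =>
    (fg_iff _).2 ⟨E y, rfl, hEf y y.2⟩
  have hSN : S ≤ N := iSup_le fun y => (closure_le _).2 (hEN y y.2)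
  have htS : zpowers t ≤ normalizer (S : Set G) := by
    rw [zpowers_le]
    refine iInf_normalizer_le_normalizer_iSup _ ?_
    simpa [mem_iInf] using fun y hy => ht y hy
  have hNS : N ≤ S ⊔ zpowers t := by
    refine le_sup_left.trans (hY.symm.le.trans ((closure_le _).2 fun y hy => ?_))
    rw [SetLike.mem_coe, ← hxz y hy]
    refine mul_mem (mem_sup_left ?_) (mem_sup_right (hz y hy))
    exact mem_iSup_of_mem (⟨y, hy⟩ : Y) (subset_closure (hxE y hy))
  have hN : N = S ⊔ (N ⊓ zpowers t) := by
    refine le_antisymm (fun u hu => ?_) (sup_le hSN inf_le_left)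
    have := hNS hu
    rw [← SetLike.mem_coe, coe_mul_of_right_le_normalizer_left _ _ htS] at this
    obtain ⟨s, hs, w, hw, rfl⟩ := this
    refine mul_mem (mem_sup_left hs) (mem_sup_right ⟨?_, hw⟩)
    exact (N.mul_mem_cancel_left (hSN hs)).1 hu
  rw [hN]
  refine hSfg.sup ?_
  have : IsCyclic (N ⊓ zpowers t : Subgroup G) := isCyclic_of_le inf_le_right
  obtain ⟨g, hg⟩ := (Subgroup.isCyclic_iff_exists_zpowers_eq_top _).1 this
  exact ⟨{g}, by rw [← hg, Finset.coe_singleton, zpowers_eq_closure]⟩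

theorem Subgroup.FG.map_monoidHom {G H : Type*} [Group G] [Group H] {N : Subgroup G} (hN : N.FG)
    (f : G →* H) : (N.map f).FG :=
  (fg_iff_submonoid_fg _).2 (((fg_iff_submonoid_fg _).1 hN).map f)

theorem Subgroup.commutator_closure_le {G : Type*} [Group G] {X Y : Set G} {D N : Subgroup G}
    (hX : X ⊆ N) (hY : Y ⊆ N) (hN : N ≤ normalizer (D : Set G))
    (h : ∀ x ∈ X, ∀ y ∈ Y, ⁅x, y⁆ ∈ D) : ⁅closure X, closure Y⁆ ≤ D := by
  have conj {g d : G} (hg : g ∈ N) (hd : d ∈ D) : g * d * g⁻¹ ∈ D :=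
    ((mem_normalizer_iff.1 (hN hg)) d).1 hd
  have conj' {g d : G} (hg : g ∈ N) (hd : d ∈ D) : g⁻¹ * d * g ∈ D := by
    simpa using conj (N.inv_mem hg) hd
  have swap {a b : G} (hab : ⁅a, b⁆ ∈ D) : ⁅b, a⁆ ∈ D := by
    rw [← commutatorElement_inv]; exact D.inv_mem hab
  have key (b : G) (Z : Set G) (hZ : Z ⊆ N) (hb : ∀ z ∈ Z, ⁅z, b⁆ ∈ D) :
      ∀ z ∈ closure Z, ⁅z, b⁆ ∈ D := fun z hz => by
    induction hz using closure_induction with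
    | mem z hz => exact hb z hz
    | one => simp
    | mul x y hx hy ihx ihy =>
      rw [commutatorElement_mul_left_eq_conj_mul]
      exact mul_mem (conj ((closure_le N).2 hZ hx) ihy) ihx
    | inv x hx ih =>
      rw [commutatorElement_inv_left]
      exact conj' ((closure_le N).2 hZ hx) (swap ih)
  rw [commutator_le]
  intro a ha b hb
  refine key b X hX (fun x hx => swap (key x Y hY (fun y hy => swap (h x hx y hy)) b hb)) a ha

/-- The factors of the lower central series of a finitely generated group are finitely
generated. -/
theorem Subgroup.FG.exists_finite_lowerCentralSeries {G : Type*} [Group G] {N : Subgroup G}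
    (hN : N.FG) (n : ℕ) : ∃ S : Set G, S.Finite ∧
      N.lowerCentralSeries n = closure S ⊔ N.lowerCentralSeries (n + 1) := by
  obtain ⟨X, hX, hXf⟩ := (fg_iff _).1 hN
  induction n with
  | zero =>
    refine ⟨X, hXf, ?_⟩
    rw [hX, Subgroup.lowerCentralSeries_zero, left_eq_sup]
    exact N.lowerCentralSeries_le_self 1
  | succ n ih =>
    obtain ⟨S, hSf, hS⟩ := ih
    let T : Set G := (fun p : G × G => ⁅p.1, p.2⁆) '' (S ×ˢ X)
    have hXN : X ⊆ N := hX ▸ subset_closure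
    have hSn : S ⊆ N.lowerCentralSeries n := by
      rw [hS]; exact subset_closure.trans (SetLike.coe_subset_coe.2 le_sup_left)
    have hT : closure T ≤ N.lowerCentralSeries (n + 1) := by
      rw [closure_le]
      rintro _ ⟨⟨s, x⟩, ⟨hs, hx⟩, rfl⟩
      exact commutator_mem_commutator (hSn hs) (hXN hx)
    have hanti := N.lowerCentralSeries_antitone (Nat.le_succ (n + 1))
    refine ⟨T, hSf.prod hXf |>.image _, le_antisymm ?_ (sup_le hT hanti)⟩
    have hnorm : N ≤ normalizer ((closure T ⊔ N.lowerCentralSeries (n + 2) : Subgroup G) :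
        Set G) := by
      rw [le_normalizer_iff_commutator_le_left]
      exact (commutator_mono (sup_le hT hanti) le_rfl).trans le_sup_right
    have := commutator_closure_le (X := S ∪ N.lowerCentralSeries (n + 1)) (Y := X) (N := N)
      (D := closure T ⊔ N.lowerCentralSeries (n + 2))
      (Set.union_subset (hSn.trans (N.lowerCentralSeries_le_self n))
        (N.lowerCentralSeries_le_self (n + 1))) hXN hnorm ?_
    · rwa [Subgroup.closure_union, closure_eq, ← hS, hX] at this
    · rintro x (hx | hx) y hy
      · exact mem_sup_left (subset_closure ⟨(x, y), ⟨hx, hy⟩, rfl⟩)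
      · exact mem_sup_right (commutator_mem_commutator hx (hXN hy))

theorem Group.isNilpotent_of_quotient_of_le_upperCentralSeries {G : Type*} [Group G]
    {C : Subgroup G} [C.Normal] {k : ℕ} (hC : C ≤ Subgroup.upperCentralSeries G k)
    (h : Group.IsNilpotent (G ⧸ C)) : Group.IsNilpotent G := by
  obtain ⟨m, hm⟩ := Subgroup.nilpotent_iff_lowerCentralSeries.1 h
  have hle : (⊤ : Subgroup G).lowerCentralSeries m ≤ Subgroup.upperCentralSeries G k := by
    refine le_trans ?_ hC
    rw [← QuotientGroup.ker_mk' C, ← Subgroup.map_eq_bot_iff, map_lowerCentralSeries,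
      map_top_of_surjective _ (QuotientGroup.mk'_surjective C), hm]
  have step (j : ℕ) (hj : j ≤ k) :
      (⊤ : Subgroup G).lowerCentralSeries (m + j) ≤ Subgroup.upperCentralSeries G (k - j) := by
    induction j with
    | zero => simpa using hle
    | succ j ih =>
      have h1 := commutator_mono (ih (by omega)) (le_refl (⊤ : Subgroup G))
      rw [show k - j = (k - (j + 1)) + 1 by omega] at h1
      exact h1.trans (commutator_upperCentralSeries_top_le G _)
  refine Subgroup.nilpotent_iff_lowerCentralSeries.2 ⟨m + k, ?_⟩
  simpa using step k le_rfl

theorem IsNilElement.isNilpotent_of_sup_zpowers {G : Type*} [Group G] {t : G}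
    (ht : IsNilElement t) {N : Subgroup G} (hNn : N.Normal) (hfg : N.FG) (c : ℕ)
    (hc : N.lowerCentralSeries c = ⊥) (htop : N ⊔ zpowers t = ⊤) : Group.IsNilpotent G := by
  induction c generalizing G with
  | zero =>
    rw [Subgroup.lowerCentralSeries_zero] at hc
    rw [hc, bot_sup_eq] at htop
    have : IsCyclic G := isCyclic_iff_exists_zpowers_eq_top.2 ⟨t, htop⟩
    let _ := IsCyclic.commGroup (α := G)
    infer_instance
  | succ c ih =>
    obtain ⟨S, hSf, hS⟩ := hfg.exists_finite_lowerCentralSeries c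
    rw [hc, sup_bot_eq] at hS
    set C := N.lowerCentralSeries c with hCdef
    have hCn : C.Normal := inferInstance
    have hSC : S ⊆ C := hS ▸ subset_closure
    have central (u : G) (hu : u ∈ C) (j : ℕ) (hj : engelWord j u t = 1) :
        u ∈ Subgroup.upperCentralSeries G j := by
      induction j generalizing u with
      | zero => simpa [engelWord] using hj
      | succ j ihj =>
        have hut : u⁻¹ * t⁻¹ * u * t ∈ C := by
          have := C.mul_mem (C.inv_mem hu) (hCn.conj_mem u hu t⁻¹)
          simpa [mul_assoc] using this
        have h1 := ihj _ hut (by rwa [← engelWord_succ'])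
        have hnorm : (⊤ : Subgroup G) ≤ normalizer (Subgroup.upperCentralSeries G j : Set G) :=
          le_normalizer_of_normal
        have h2 := commutator_closure_le (X := {u}) (Y := N ∪ {t}) (N := ⊤)
          (D := Subgroup.upperCentralSeries G j) (by simp) (by simp) hnorm ?_
        · rw [Subgroup.closure_union, closure_eq, ← zpowers_eq_closure t, htop] at h2
          rw [Subgroup.mem_upperCentralSeries_succ_iff]
          intro y
          exact h2 (commutator_mem_commutator (mem_closure_singleton_self u) (mem_top y))
        · rintro x rfl y (hy | rfl)
          · have : ⁅x, y⁆ ∈ N.lowerCentralSeries (c + 1) := commutator_mem_commutator hu hy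
            rw [hc, mem_bot] at this
            rw [this]; exact one_mem _
          · have := (inferInstance : (Subgroup.upperCentralSeries G j).Normal).conj_mem _ h1 (y * x)
            convert this using 1
            rw [commutatorElement_def]
            group
    choose k _ hk using fun u : G => ht u
    have hCk : C ≤ Subgroup.upperCentralSeries G (hSf.toFinset.sup k) := by
      rw [hS, closure_le]
      intro s hs
      exact Subgroup.upperCentralSeries_mono G (Finset.le_sup (hSf.mem_toFinset.2 hs))
        (central s (hSC hs) _ (hk s))
    refine Group.isNilpotent_of_quotient_of_le_upperCentralSeries hCk ?_
    have hsurj := QuotientGroup.mk'_surjective C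
    refine ih (G := G ⧸ C) (t := QuotientGroup.mk' C t) (N := N.map (QuotientGroup.mk' C)) ?_
      (hNn.map _ hsurj) (hfg.map_monoidHom _) ?_ ?_
    · intro a
      obtain ⟨a, rfl⟩ := hsurj a
      obtain ⟨n, hn, e⟩ := ht a
      exact ⟨n, hn, by rw [← map_engelWord, e, map_one]⟩
    · rw [← map_lowerCentralSeries, Subgroup.map_eq_bot_iff, QuotientGroup.ker_mk']
    · rw [← MonoidHom.map_zpowers, ← Subgroup.map_sup, htop, map_top_of_surjective _ hsurj]

theorem Subgroup.map_subtype_derivedSeries_commutator (G : Type*) [Group G] (n : ℕ) :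
    (derivedSeries (_root_.commutator G) n).map (_root_.commutator G).subtype = derivedSeries G (n + 1) := by
  induction n with
  | zero => simp [← MonoidHom.range_eq_map]
  | succ n ih => rw [derivedSeries_succ, map_commutator, ih, ← derivedSeries_succ]

/-- In an Engel group, a finitely generated group has finitely generated commutator subgroup. -/
theorem IsEngelGroup.fg_of_commutator_le {G : Type*} [Group G] (h : IsEngelGroup G)
    {N : Subgroup G} (hN : _root_.commutator G ≤ N) {T : Set G} (hT : T.Finite)
    (hfg : (N ⊔ closure T).FG) : N.FG := by
  induction T, hT using Set.Finite.induction_on with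
  | empty => simpa using hfg
  | @insert t T _ _ ih =>
    refine ih ?_
    have : (N ⊔ closure T).Normal := Subgroup.Normal.of_commutator_le _ (hN.trans le_sup_left)
    refine h.fg_of_sup_zpowers _ t ?_
    rwa [sup_assoc, zpowers_eq_closure, ← Subgroup.closure_union, Set.union_singleton]

theorem IsEngelGroup.isNilpotent_sup_closure {G : Type*} [Group G] (h : IsEngelGroup G)
    {N : Subgroup G} (hN : _root_.commutator G ≤ N) (hfg : N.FG) (hnil : Group.IsNilpotent N)
    {T : Set G} (hT : T.Finite) : Group.IsNilpotent (N ⊔ closure T : Subgroup G) := by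
  induction T, hT using Set.Finite.induction_on with
  | empty => rwa [Subgroup.closure_empty, sup_bot_eq]
  | @insert t T _ hTf ih =>
    let M : Subgroup G := N ⊔ closure T
    have hM : M.Normal := Subgroup.Normal.of_commutator_le _ (hN.trans le_sup_left)
    have hMfg : M.FG := hfg.sup ((fg_iff _).2 ⟨T, rfl, hTf⟩)
    obtain ⟨c, hc⟩ := (isNilpotent_iff_lowerCentralSeries M).1 ih
    let L : Subgroup G := M ⊔ zpowers t
    have hL : N ⊔ closure (insert t T) = L := by
      rw [← Set.union_singleton, Subgroup.closure_union, ← zpowers_eq_closure, ← sup_assoc]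
    rw [hL]
    have hML : M ≤ L := le_sup_left
    have htL : t ∈ L := mem_sup_right (mem_zpowers t)
    have hmap : (M.subgroupOf L).map L.subtype = M := map_subgroupOf_eq_of_le hML
    have hinj := L.subtype_injective
    refine (h.subgroup L ⟨t, htL⟩).isNilpotent_of_sup_zpowers (N := M.subgroupOf L) inferInstance
      ?_ c ?_ ?_
    · rw [← Group.fg_iff_subgroup_fg] at hMfg ⊢
      exact Group.fg_of_surjective (f := (subgroupOfEquivOfLe hML).symm.toMonoidHom)
        (subgroupOfEquivOfLe hML).symm.surjective
    · rw [← (map_injective hinj).eq_iff, map_lowerCentralSeries, hmap, hc, Subgroup.map_bot]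
    · rw [← (map_injective hinj).eq_iff, Subgroup.map_sup, hmap, MonoidHom.map_zpowers,
        ← MonoidHom.range_eq_map, range_subtype]
      rfl

/-- A finitely generated solvable Engel group is nilpotent. -/
theorem IsEngelGroup.isNilpotent_of_derivedSeries_eq_bot {G : Type*} [Group G]
    (h : IsEngelGroup G) (hfg : Group.FG G) {d : ℕ} (hd : derivedSeries G d = ⊥) :
    Group.IsNilpotent G := by
  induction d generalizing G with
  | zero =>
    have : Subsingleton G := by simpa [subsingleton_iff_bot_eq_top, eq_comm] using hd
    infer_instance
  | succ d ih =>
    obtain ⟨T, hT, hTf⟩ := Group.fg_iff.1 hfg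
    have hcfg : (_root_.commutator G).FG := by
      refine h.fg_of_commutator_le le_rfl hTf ?_
      rw [hT, sup_top_eq]
      exact Group.fg_def.1 hfg
    have hnil : Group.IsNilpotent (_root_.commutator G) := by
      refine ih (h.subgroup _) ((Group.fg_iff_subgroup_fg _).2 hcfg) ?_
      rw [← (map_injective (_root_.commutator G).subtype_injective).eq_iff,
        map_subtype_derivedSeries_commutator, hd, Subgroup.map_bot]
    have := h.isNilpotent_sup_closure le_rfl hcfg hnil hTf
    rw [hT, sup_top_eq] at this
    exact Group.isNilpotent_top.1 this

/-- **Zorn's theorem**: a finite Engel group is nilpotent. -/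
theorem IsEngelGroup.isNilpotent_of_finite {G : Type*} [Group G] [Finite G]
    (h : IsEngelGroup G) : Group.IsNilpotent G := by
  induction hn : Nat.card G using Nat.strong_induction_on generalizing G with
  | _ n ih =>
  subst hn
  have hsub (H : Subgroup G) (hH : H ≠ ⊤) : Group.IsNilpotent H :=
    ih _ (lt_of_le_of_ne (card_le_card_group H) fun e => hH ((card_eq_iff_eq_top H).1 e))
      (h.subgroup H) rfl
  by_cases hD : ∃ D : Subgroup G, D.Normal ∧ D ≠ ⊥ ∧ D ≠ ⊤
  · obtain ⟨D, hDn, hb, ht⟩ := hD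
    have h1 := hsub D ht
    have h2 : Group.IsNilpotent (G ⧸ D) := by
      refine ih _ ?_ (h.of_surjective (QuotientGroup.mk' D) (QuotientGroup.mk'_surjective D)) rfl
      rw [D.card_eq_card_quotient_mul_card_subgroup]
      exact lt_mul_of_one_lt_right Nat.card_pos (D.one_lt_card_iff_ne_bot.2 hb)
    obtain ⟨d, hd⟩ := ((Group.isSolvable_iff_subgroup_quotient D).2
      ⟨inferInstance, inferInstance⟩).solvable
    exact h.isNilpotent_of_derivedSeries_eq_bot inferInstance hd
  push Not at hD
  refine ((Group.isNilpotent_of_finite_tfae (G := G)).out 0 2).2 ?_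
  intro M hM
  by_contra hMn
  have hgrow (D A : Subgroup G) (hA : A ≠ ⊤) (hDA : D < A) :
      ∃ x ∈ A, x ∉ D ∧ x ∈ normalizer (D : Set G) := by
    have := hsub A hA
    have h1 := Group.normalizerCondition_of_isNilpotent (G := A) (D.subgroupOf A)
      (lt_top_iff_ne_top.2 fun e => hDA.not_ge (subgroupOf_eq_top.1 e))
    rw [← subgroupOf_normalizer_eq hDA.le] at h1
    obtain ⟨x, hx, hxD⟩ := SetLike.exists_of_lt h1
    exact ⟨x, x.2, hxD, hx⟩
  have inf_lt {A B : Subgroup G} (hA : IsCoatom A) (hB : IsCoatom B) (hAB : A ≠ B) :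
      A ⊓ B < A :=
    inf_lt_left.2 fun hle => hAB ((hA.le_iff_eq hB.1).1 hle).symm
  let P : Set (Subgroup G) :=
    {D | ∃ A B : Subgroup G, IsCoatom A ∧ IsCoatom B ∧ A ≠ B ∧ A ⊓ B = D}
  have hPbot : ∀ D ∈ P, D = ⊥ := by
    intro D₀ hD₀
    obtain ⟨D, hle, hDmax⟩ := (Set.toFinite P).exists_le_maximal hD₀
    suffices D = ⊥ from le_bot_iff.1 (hle.trans this.le)
    obtain ⟨A, B, hA, hB, hAB, hABD⟩ := hDmax.prop
    by_contra hDbot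
    have hDn : ¬ D.Normal := fun hn =>
      hA.1 (top_le_iff.1 ((hD D hn hDbot).ge.trans (hABD ▸ inf_le_left)))
    obtain ⟨C, hC, hNC⟩ : ∃ C : Subgroup G, IsCoatom C ∧ normalizer (D : Set G) ≤ C :=
      (eq_top_or_exists_le_coatom _).resolve_left fun e => hDn (normalizer_eq_top_iff.1 e)
    have key (E : Subgroup G) (hE : IsCoatom E) (hDE : D < E) : C = E := by
      by_contra hCE
      obtain ⟨x, hxE, hxD, hxN⟩ := hgrow D E hE.1 hDE
      have h1 : D ≤ C ⊓ E := le_inf (le_normalizer.trans hNC) hDE.le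
      exact hxD (hDmax.le_of_ge ⟨C, E, hC, hE, hCE, rfl⟩ h1 ⟨hNC hxN, hxE⟩)
    refine hAB ((key A hA ?_).symm.trans (key B hB ?_))
    · exact hABD ▸ inf_lt hA hB hAB
    · rw [← hABD, inf_comm]
      exact inf_lt hB hA hAB.symm
  obtain ⟨⟨x, hxM⟩, hx1⟩ := M.ne_bot_iff_exists_ne_one.1 fun e => hMn (e ▸ inferInstance)
  replace hx1 : x ≠ 1 := fun e => hx1 (Subtype.ext e)
  obtain ⟨a, ha⟩ : ∃ a, a ∉ M := by
    by_contra! hall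
    exact hM.1 ((eq_top_iff' M).2 hall)
  obtain ⟨b, hbM, hb⟩ : ∃ b, b ∉ M ∧ b⁻¹ * x * b ∈ M := by
    by_contra! hno
    have (j : ℕ) : engelWord j a x ∉ M := by
      induction j with
      | zero => exact ha
      | succ j ihj =>
        intro hj
        apply hno _ ihj
        have := M.inv_mem ((M.mul_mem_cancel_right hxM).1 hj)
        simpa [mul_assoc] using this
    obtain ⟨k, -, hk⟩ := h x a
    exact this k (hk ▸ M.one_mem)
  have hMB : M = M.map (MulAut.conj b).toMonoidHom := by
    by_contra hne
    have hB : IsCoatom (M.map (MulAut.conj b).toMonoidHom) :=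
      ((MulAut.conj b).mapSubgroup.isCoatom_iff M).2 hM
    have := hPbot _ ⟨M, _, hM, hB, hne, rfl⟩
    refine hx1 ((mem_bot (G := G)).1 (this ▸ ⟨hxM, _, hb, ?_⟩))
    simp [mul_assoc]
  have hbN : b ∈ normalizer (M : Set G) := mem_normalizer_iff_map_conj_eq.2 hMB.symm
  refine hMn (normalizer_eq_top_iff.1 (hM.2 _ (lt_of_le_of_ne le_normalizer fun e => ?_)))
  exact hbM (e ▸ hbN)

/-- Two operators acting trivially on a subspace and on the quotient by it commute. -/
theorem Module.End.commute_of_trivial_on_submodule_and_quotient {K V : Type*} [Field K]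
    [AddCommGroup V] [Module K V] {E : Submodule K V} {f g : Module.End K V}
    (hf : ∀ v ∈ E, f v = v) (hf' : ∀ v, f v - v ∈ E) (hg : ∀ v ∈ E, g v = v)
    (hg' : ∀ v, g v - v ∈ E) : Commute f g := by
  refine LinearMap.ext fun v => ?_
  have h1 := hf _ (hg' v)
  have h2 := hg _ (hf' v)
  rw [map_sub, sub_eq_iff_eq_add] at h1 h2
  rw [Module.End.mul_apply, Module.End.mul_apply, h1, h2]
  abel

theorem MonoidHom.eq_one_of_mem_commutator {G U : Type*} [Group G] [Group U] (f : G →* U)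
    (hf : ∀ g h, Commute (f g) (f h)) {g : G} (hg : g ∈ _root_.commutator G) : f g = 1 := by
  suffices _root_.commutator G ≤ f.ker from this hg
  rw [_root_.commutator_def, commutator_le]
  intro g _ h _
  rw [MonoidHom.mem_ker, map_commutatorElement, commutatorElement_eq_one_iff_commute]
  exact hf g h

theorem commute_of_mem_commutator {G U : Type*} [Group G] [Group U] {f : G →* U} {a : U}
    (ha : ∀ g, ⁅a, f g⁆ ∈ center U) {g : G} (hg : g ∈ _root_.commutator G) :
    Commute a (f g) := by
  let φ : G →* center U := MonoidHom.mk' (fun g => ⟨⁅a, f g⁆, ha g⟩) fun g h => by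
    ext
    have := mem_center_iff.1 (ha h) (f g)
    simp only [map_mul, Subgroup.coe_mul]
    calc ⁅a, f g * f h⁆ = ⁅a, f g⁆ * (f g * ⁅a, f h⁆) * (f g)⁻¹ := by
          simp only [commutatorElement_def]; group
      _ = _ := by rw [this]; group
  have := φ.eq_one_of_mem_commutator (fun g h => Subtype.ext (mem_center_iff.1 (φ h).2 _)) hg
  exact commutatorElement_eq_one_iff_commute.1 (congrArg Subtype.val this)

theorem Representation.exists_nonscalar_forall_commutatorElement_scalar {K V G : Type*} [Field K]
    [AddCommGroup V] [Module K V] [Group G] [Group.IsNilpotent G] (ρ : Representation K G V)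
    (hρ : ¬ ∀ g, ∃ c : K, ρ g = c • 1) :
    ∃ a : G, (¬ ∃ c : K, ρ a = c • 1) ∧ ∀ g, ∃ c : K, ρ ⁅a, g⁆ = c • 1 := by
  obtain ⟨n, hn⟩ := Group.IsNilpotent.nilpotent G
  have hex : ∃ i, ∃ a ∈ Subgroup.upperCentralSeries G i, ¬ ∃ c : K, ρ a = c • 1 := by
    push Not at hρ
    obtain ⟨g, hg⟩ := hρ
    exact ⟨n, g, hn ▸ mem_top g, by simpa using hg⟩
  classical
  obtain ⟨a, ha, hna⟩ := Nat.find_spec hex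
  refine ⟨a, hna, fun g => ?_⟩
  by_contra hc
  cases hi : Nat.find hex with
  | zero =>
    rw [hi] at ha
    have : a = 1 := by simpa using ha
    exact hna ⟨1, by simp [this]⟩
  | succ i =>
    rw [hi] at ha
    refine Nat.find_min hex (m := i) (by omega) ⟨_, ?_, hc⟩
    exact Subgroup.mem_upperCentralSeries_succ_iff.1 ha g

/-- If a nilpotent group does not act by scalars, its commutator subgroup commutes with some
nonscalar operator. -/
theorem Representation.exists_nonscalar_commute_commutator {K V G : Type*} [Field K]
    [AddCommGroup V] [Module K V] [Group G] [Group.IsNilpotent G] (ρ : Representation K G V)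
    (hρ : ¬ ∀ g, ∃ c : K, ρ g = c • 1) :
    ∃ a : Module.End K V, (¬ ∃ c : K, a = c • 1) ∧
      ∀ g ∈ _root_.commutator G, Commute a (ρ g) := by
  obtain ⟨a, hna, ha⟩ := ρ.exists_nonscalar_forall_commutatorElement_scalar hρ
  refine ⟨ρ a, hna, fun g hg => ?_⟩
  have hcen (k : G) : ⁅MonoidHom.toHomUnits ρ a, MonoidHom.toHomUnits ρ k⁆ ∈
      center (Module.End K V)ˣ := by
    obtain ⟨c, hc⟩ := ha k
    rw [← map_commutatorElement, mem_center_iff]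
    intro u
    ext1
    change (u : Module.End K V) * ρ ⁅a, k⁆ = ρ ⁅a, k⁆ * u
    simp [hc]
  exact (commute_of_mem_commutator hcen hg).units_val

/-- A nilpotent linear group of degree at most `n` has derived length at most `2 * n`. -/
theorem Representation.apply_eq_one_of_mem_derivedSeries {K : Type*} [Field K] [IsAlgClosed K] (n : ℕ)
    {V : Type*} [AddCommGroup V] [Module K V] [FiniteDimensional K V]
    (hV : Module.finrank K V ≤ n) {G : Type*} [Group G] [Group.IsNilpotent G]
    (ρ : Representation K G V) {g : G} (hg : g ∈ derivedSeries G (2 * n)) : ρ g = 1 := by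
  induction n generalizing V G with
  | zero =>
    have : Subsingleton V := Module.finrank_zero_iff.1 (Nat.le_zero.1 hV)
    exact Subsingleton.elim _ _
  | succ n ih =>
  by_cases hρ : ∀ g, ∃ c : K, ρ g = c • 1
  · have hg1 : g ∈ _root_.commutator G := by
      rw [← derivedSeries_one]
      exact derivedSeries_antitone G (by omega) hg
    refine Units.ext_iff.1 ((MonoidHom.toHomUnits ρ).eq_one_of_mem_commutator (fun x y => ?_) hg1)
    obtain ⟨c, hc⟩ := hρ x
    refine Units.ext ?_
    change ρ x * ρ y = ρ y * ρ x
    simp [hc]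
  obtain ⟨a, hna, hcomm⟩ := ρ.exists_nonscalar_commute_commutator hρ
  have : Nontrivial V := by
    by_contra! hsub
    exact hna ⟨0, LinearMap.ext fun v => Subsingleton.elim _ _⟩
  obtain ⟨μ, hμ⟩ := Module.End.exists_eigenvalue a
  let E := a.eigenspace μ
  have hEtop : E ≠ ⊤ := by
    intro e
    refine hna ⟨μ, LinearMap.ext fun v => ?_⟩
    exact Module.End.mem_eigenspace_iff.1 (e ▸ Submodule.mem_top : v ∈ E)
  have hE1 : Module.finrank K E ≤ n := by
    have := Submodule.finrank_lt hEtop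
    omega
  have hE2 : Module.finrank K (V ⧸ E) ≤ n := by
    have h1 := E.finrank_quotient_add_finrank
    have h2 : Module.finrank K E ≠ 0 := fun h0 => hμ (Submodule.finrank_eq_zero.1 h0)
    omega
  let σ : Representation K (_root_.commutator G) V := ρ.comp (_root_.commutator G).subtype
  have hinv (g : _root_.commutator G) : E ≤ E.comap (σ g) :=
    Module.End.mapsTo_genEigenspace_of_comm (hcomm g g.2) μ 1
  have h1 (g) (hg : g ∈ derivedSeries (_root_.commutator G) (2 * n)) :
      (∀ v ∈ E, σ g v = v) ∧ ∀ v, σ g v - v ∈ E := by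
    refine ⟨fun v hv => ?_, fun v => ?_⟩
    · exact congrArg Subtype.val
        (LinearMap.congr_fun (ih hE1 (σ.subrepresentation E hinv) hg) ⟨v, hv⟩)
    · exact (Submodule.Quotient.eq E).1
        (LinearMap.congr_fun (ih hE2 (σ.quotient E hinv) hg) (E.mkQ v))
  have h2 : derivedSeries (_root_.commutator G) (2 * n + 1) ≤ MonoidHom.ker σ := by
    rw [derivedSeries_succ, commutator_le, ← MonoidHom.ker_toHomUnits]
    intro x hx y hy
    rw [MonoidHom.mem_ker, map_commutatorElement, commutatorElement_eq_one_iff_commute]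
    refine Units.ext ?_
    exact Module.End.commute_of_trivial_on_submodule_and_quotient (h1 x hx).1 (h1 x hx).2
      (h1 y hy).1 (h1 y hy).2
  rw [show 2 * (n + 1) = 2 * n + 1 + 1 by ring, ← map_subtype_derivedSeries_commutator] at hg
  obtain ⟨x, hx, rfl⟩ := hg
  exact h2 hx

instance Int.isJacobsonRing : IsJacobsonRing ℤ := by
  rw [isJacobsonRing_iff_prime_eq]
  intro p hp
  rcases eq_or_ne p ⊥ with rfl | hne
  · refine le_bot_iff.1 fun x hx => ?_
    rw [Ideal.mem_jacobson_bot] at hx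
    rw [Ideal.mem_bot]
    by_contra hx0
    have h1 := Int.isUnit_iff.1 (hx 2)
    have h2 := Int.isUnit_iff.1 (hx (-2))
    omega
  · have := hp.isMaximal hne
    exact Ideal.jacobson_eq_self_of_isMaximal

theorem Field.finite_of_finiteType_int (k : Type*) [Field k] [Algebra.FiniteType ℤ k] :
    Finite k := by
  have hfin : Module.Finite ℤ k := finite_of_finite_type_of_isJacobsonRing ℤ k
  obtain ⟨p, hp⟩ := CharP.exists k
  rcases eq_or_ne p 0 with rfl | hp0
  · exfalso
    have : CharZero k := CharP.charP_to_charZero k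
    have : Algebra.IsIntegral ℤ k := inferInstance
    exact Int.not_isField (isField_of_isIntegral_of_isField (S := k)
      (algebraMap ℤ k).injective_int (Field.toIsField k))
  · have : Module.IsTorsion ℤ k := by
      intro x
      refine ⟨⟨p, mem_nonZeroDivisors_of_ne_zero (by exact_mod_cast hp0)⟩, ?_⟩
      change (p : ℤ) • x = 0
      simp
    exact Module.finite_of_fg_torsion k this

theorem exists_isMaximal_finite_quotient (R : Type*) [CommRing R] [IsDomain R]
    [Algebra.FiniteType ℤ R] {d : R} (hd : d ≠ 0) :
    ∃ m : Ideal R, m.IsMaximal ∧ d ∉ m ∧ Finite (R ⧸ m) := by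
  have : IsJacobsonRing R := isJacobsonRing_of_finiteType (A := ℤ)
  have hbot : (⊥ : Ideal R).jacobson = ⊥ :=
    isJacobsonRing_iff_prime_eq.1 this ⊥ Ideal.isPrime_bot
  have hdj : d ∉ (⊥ : Ideal R).jacobson := by rwa [hbot, Ideal.mem_bot]
  rw [Ideal.jacobson, Ideal.mem_sInf] at hdj
  push Not at hdj
  obtain ⟨m, ⟨-, hm⟩, hdm⟩ := hdj
  have : Algebra.FiniteType ℤ (R ⧸ m) :=
    .of_surjective (Ideal.Quotient.mkₐ ℤ m) (Ideal.Quotient.mkₐ_surjective ℤ m)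
  exact ⟨m, hm, hdm, @Field.finite_of_finiteType_int _ (Ideal.Quotient.field m) this⟩

theorem Matrix.GeneralLinearGroup.mem_range_map {P ι : Type*} [Field P] [Fintype ι] [DecidableEq ι]
    {A : Subalgebra ℤ P} {g : GL ι P} (hg : ∀ i j, g i j ∈ A)
    (hg' : ∀ i j, g⁻¹ i j ∈ A) : g ∈ (map (n := ι) (algebraMap A P)).range := by
  have hinj : Function.Injective ((algebraMap A P).mapMatrix (m := ι)) :=
    Matrix.map_injective Subtype.val_injective
  let x : Matrix ι ι A := fun i j => ⟨_, hg i j⟩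
  let y : Matrix ι ι A := fun i j => ⟨_, hg' i j⟩
  have hx : (algebraMap A P).mapMatrix x = (g : Matrix ι ι P) := rfl
  have hy : (algebraMap A P).mapMatrix y = ((g⁻¹ : GL ι P) : Matrix ι ι P) := rfl
  refine ⟨⟨x, y, hinj ?_, hinj ?_⟩, Units.ext rfl⟩
  · rw [map_mul, hx, hy, map_one, Units.mul_inv]
  · rw [map_mul, hx, hy, map_one, Units.inv_mul]

/-- **Malcev's theorem**: finitely generated linear groups are residually finite. -/
theorem Matrix.GeneralLinearGroup.exists_finite_field_map_ne_one.{u, v} {P : Type u} {ι : Type v}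
    [Field P] [Fintype ι] [DecidableEq ι] {H : Subgroup (GL ι P)} (hH : H.FG) {h : H} (hh : h ≠ 1) :
    ∃ (k : Type u) (_ : Field k) (_ : Finite k) (φ : H →* GL ι k), φ h ≠ 1 := by
  obtain ⟨S, rfl, hS⟩ := (fg_iff H).1 hH
  let T : Set P := ⋃ g ∈ S, ⋃ i, ⋃ j, {g i j, g⁻¹ i j}
  have hT : T.Finite := hS.biUnion fun _ _ => Set.finite_iUnion fun _ => Set.finite_iUnion fun _ =>
    Set.toFinite _
  let A := Algebra.adjoin ℤ T
  have hA : Algebra.FiniteType ℤ A := .adjoin_of_finite hT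
  have hinj : Function.Injective (map (n := ι) (algebraMap A P)) :=
    Units.map_injective (Matrix.map_injective Subtype.val_injective)
  have hle : closure S ≤ (map (n := ι) (algebraMap A P)).range := by
    rw [closure_le]
    refine fun g hg => mem_range_map (fun i j => Algebra.subset_adjoin ?_)
      fun i j => Algebra.subset_adjoin ?_
    all_goals
      simp only [T, Set.mem_iUnion]
      exact ⟨g, hg, i, j, by simp⟩
  let ψ : closure S →* GL ι A :=
    (MonoidHom.ofInjective hinj).symm.toMonoidHom.comp (Subgroup.inclusion hle)
  have hψ : ψ h ≠ 1 := by
    intro e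
    refine hh (inclusion_injective hle ((MonoidHom.ofInjective hinj).symm.injective ?_))
    rw [map_one, map_one]
    exact e
  obtain ⟨i, j, hij⟩ : ∃ i j, ψ h i j ≠ (1 : Matrix ι ι A) i j := by
    by_contra! hall
    exact hψ (Units.ext (Matrix.ext hall))
  obtain ⟨m, hm, hdm, hfin⟩ := exists_isMaximal_finite_quotient A (sub_ne_zero.2 hij)
  refine ⟨A ⧸ m, Ideal.Quotient.field m, hfin, (map (Ideal.Quotient.mk m)).comp ψ, fun e => hdm ?_⟩
  rw [← Ideal.Quotient.eq_zero_iff_mem, map_sub, sub_eq_zero]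
  have h1 : Ideal.Quotient.mk m (ψ h i j) = (1 : Matrix ι ι (A ⧸ m)) i j :=
    congrArg (fun g : GL ι (A ⧸ m) => g i j) e
  rw [h1, Matrix.one_apply, Matrix.one_apply]
  split <;> simp

theorem Matrix.GeneralLinearGroup.derivedSeries_eq_bot {k : Type*} [Field k] {n : ℕ}
    (N : Subgroup (GL (Fin n) k)) [Group.IsNilpotent N] : derivedSeries N (2 * n) = ⊥ := by
  let K := AlgebraicClosure k
  let ρ : Representation K N (Fin n → K) :=
    ((Matrix.toLinAlgEquiv' (R := K) (n := Fin n)).toMonoidHom.comp (Units.coeHom _)).comp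
      ((map (algebraMap k K)).comp N.subtype)
  have hρ : Function.Injective ρ :=
    Matrix.toLinAlgEquiv'.injective.comp (Units.val_injective.comp
      ((Units.map_injective (Matrix.map_injective (algebraMap k K).injective)).comp
        N.subtype_injective))
  refine (eq_bot_iff_forall _).2 fun g hg => hρ ?_
  rw [ρ.apply_eq_one_of_mem_derivedSeries n (by simp) hg, map_one]

theorem IsEngelGroup.derivedSeries_eq_bot_of_linear {P : Type*} [Field P] {n : ℕ}
    {H : Subgroup (GL (Fin n) P)} (hfg : H.FG) (h : IsEngelGroup H) :
    derivedSeries H (2 * n) = ⊥ := by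
  refine (eq_bot_iff_forall _).2 fun g hg => ?_
  by_contra hg1
  obtain ⟨k, _, _, φ, hφ⟩ := Matrix.GeneralLinearGroup.exists_finite_field_map_ne_one hfg hg1
  have : Finite φ.range := inferInstance
  have : Group.IsNilpotent φ.range :=
    (h.of_surjective φ.rangeRestrict φ.rangeRestrict_surjective).isNilpotent_of_finite
  have h1 : φ.rangeRestrict g ∈ derivedSeries φ.range (2 * n) :=
    map_derivedSeries_le_derivedSeries φ.rangeRestrict _ (mem_map_of_mem _ hg)
  rw [Matrix.GeneralLinearGroup.derivedSeries_eq_bot, Subgroup.mem_bot] at h1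
  exact hφ (congrArg Subtype.val h1)

/-- a subgroup of `GL_n(P)`, `P` a field, all of whose elements are
nil-elements is locally nilpotent. -/
theorem locallyNilpotent_of_all_nil_linear (P : Type*) [Field P] (n : ℕ) (hn : 1 ≤ n)
    (G : Subgroup (Matrix.GeneralLinearGroup (Fin n) P))
    (h : ∀ g : G, IsNilElement g) :
    LocallyNilpotent G := by
  intro H hH
  have hfg : (H.map G.subtype).FG := hH.map_monoidHom _
  let e : H ≃* H.map G.subtype := H.equivMapOfInjective _ G.subtype_injective
  have hE : IsEngelGroup H := IsEngelGroup.subgroup h H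
  have hE1 : IsEngelGroup (H.map G.subtype) := hE.of_surjective e.toMonoidHom e.surjective
  have hnil := hE1.isNilpotent_of_derivedSeries_eq_bot ((Group.fg_iff_subgroup_fg _).2 hfg)
    (hE1.derivedSeries_eq_bot_of_linear hfg)
  exact Group.nilpotent_of_mulEquiv e.symm
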